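/- Let N be the nest {0} = N₀ < N₁ < N₂ < ⋯ with finite-dimensional atoms of ranks nₖ satisfying nₖ ≥ 4·Σ_{i<k} nᵢ. Then the left topological stable rank of T(N) is infinite, while its right topological stable rank is 2; in particular ltsr(T(N)) ≠ rtsr(T(N)). -/

import Mathlib

/-- `n`-tuples generating `A` as a left ideal. -/
noncomputable def Lg (A : Type*) [NormedRing A] (n : ℕ) : Set (Fin n → A) :=
  {a | ∃ b : Fin n → A, ∑ i, b i * a i = 1}

/-- `n`-tuples generating `A` as a right ideal. -/
noncomputable def Rg (A : Type*) [NormedRing A] (n : ℕ) : Set (Fin n → A) :=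
  {a | ∃ b : Fin n → A, ∑ i, a i * b i = 1}

/-- The left topological stable rank. -/
noncomputable def ltsr (A : Type*) [NormedRing A] : ℕ∞ :=
  sInf {N : ℕ∞ | ∃ n : ℕ, N = n ∧ Dense (Lg A n)}

/-- The right topological stable rank. -/
noncomputable def rtsr (A : Type*) [NormedRing A] : ℕ∞ :=
  sInf {N : ℕ∞ | ∃ n : ℕ, N = n ∧ Dense (Rg A n)}


/-- A nest: a chain of closed subspaces containing `{0}` and `H`, closed under
intersections and closed linear spans. -/
structure IsNest {H : Type*} [NormedAddCommGroup H] [InnerProductSpace ℂ H]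
    (𝒩 : Set (Submodule ℂ H)) : Prop where
  isClosed : ∀ N ∈ 𝒩, IsClosed (N : Set H)
  isChain : IsChain (· ≤ ·) 𝒩
  bot_mem : ⊥ ∈ 𝒩
  top_mem : ⊤ ∈ 𝒩
  sInf_mem : ∀ S ⊆ 𝒩, S.Nonempty → sInf S ∈ 𝒩
  span_mem : ∀ S ⊆ 𝒩, S.Nonempty → (sSup S).topologicalClosure ∈ 𝒩

/-- The nest algebra of all bounded operators leaving every subspace of `𝒩` invariant. -/
noncomputable def nestAlgebra {H : Type*} [NormedAddCommGroup H] [InnerProductSpace ℂ H]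
    (𝒩 : Set (Submodule ℂ H)) : Subalgebra ℂ (H →L[ℂ] H) where
  carrier := {T | ∀ N ∈ 𝒩, ∀ x ∈ N, T x ∈ N}
  mul_mem' := fun hT hS N hN x hx => hT N hN _ (hS N hN x hx)
  add_mem' := fun hT hS N hN x hx => N.add_mem (hT N hN x hx) (hS N hN x hx)
  algebraMap_mem' := fun c N hN x hx => by
    simpa [Algebra.algebraMap_eq_smul_one] using N.smul_mem c hx


open scoped InnerProductSpace

section aux

variable {H : Type*} [NormedAddCommGroup H] [InnerProductSpace ℂ H]

/-- The atoms of the nest. -/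
noncomputable def atomE (N : ℕ → Submodule ℂ H) (k : ℕ) : Submodule ℂ H := N (k + 1) ⊓ (N k)ᗮ

/-- An orthonormal family adapted to the nest. -/
structure Adapted (N : ℕ → Submodule ℂ H) {m : ℕ → ℕ} (e : (Σ k, Fin (m k)) → H) : Prop where
  on : Orthonormal ℂ e
  span : ∀ k, Submodule.span ℂ (Set.range fun i => e ⟨k, i⟩) = atomE N k

theorem adapted_of {N : ℕ → Submodule ℂ H} (hmono : StrictMono N) {m : ℕ → ℕ}
    (e : ∀ k, Fin (m k) → H) (h1 : ∀ k, Orthonormal ℂ (e k))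
    (h2 : ∀ k, Submodule.span ℂ (Set.range (e k)) = atomE N k) :
    Adapted N (fun i : (Σ k, Fin (m k)) => e i.1 i.2) where
  on := by
    have hmem : ∀ k i, e k i ∈ atomE N k := fun k i => by
      rw [← h2]; exact Submodule.subset_span ⟨i, rfl⟩
    have key : ∀ k l, k < l → ∀ i j, ⟪e k i, e l j⟫_ℂ = 0 := by
      intro k l hkl i j
      exact (Submodule.mem_orthogonal _ _).1 (hmem l j).2 _
        (hmono.monotone (Nat.succ_le_of_lt hkl) (hmem k i).1)
    refine ⟨fun i => (h1 i.1).1 i.2, ?_⟩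
    rintro ⟨k, i⟩ ⟨l, j⟩ hne
    rcases lt_trichotomy k l with h | h | h
    · exact key k l h i j
    · subst h
      exact (h1 k).2 (fun h : i = j => hne (by rw [h]))
    · exact inner_eq_zero_symm.1 (key l k h j i)
  span := h2

theorem Adapted.mem {N : ℕ → Submodule ℂ H} {m : ℕ → ℕ} {e : (Σ k, Fin (m k)) → H}
    (he : Adapted N e) (i) : e i ∈ atomE N i.1 := by
  rw [← he.span]; exact Submodule.subset_span ⟨i.2, rfl⟩

theorem Adapted.le_span {N : ℕ → Submodule ℂ H} (hbot : N 0 = ⊥) (hmono : StrictMono N)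
    (hfd : ∀ k, FiniteDimensional ℂ (N k)) {m : ℕ → ℕ} {e : (Σ k, Fin (m k)) → H}
    (he : Adapted N e) (k : ℕ) : N k = Submodule.span ℂ (e '' {i | i.1 < k}) := by
  apply le_antisymm
  · induction k with
    | zero => simp [hbot]
    | succ k ih =>
      have := hfd k
      have h1 : N k ⊔ atomE N k = N (k + 1) :=  by
        rw [atomE, inf_comm]
        exact Submodule.sup_orthogonal_inf_of_hasOrthogonalProjection (hmono.monotone (Nat.le_succ k))
      rw [← h1]
      refine sup_le (ih.trans (Submodule.span_mono (Set.image_mono fun i hi => ?_))) ?_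
      · exact Nat.lt_succ_of_lt hi
      · rw [← he.span]
        refine Submodule.span_mono ?_
        rintro _ ⟨i, rfl⟩
        exact ⟨⟨k, i⟩, Nat.lt_succ_self k, rfl⟩
  · rw [Submodule.span_le]
    rintro _ ⟨i, hi, rfl⟩
    exact hmono.monotone (Nat.succ_le_of_lt hi) (he.mem i).1

theorem Adapted.dense {N : ℕ → Submodule ℂ H} (hbot : N 0 = ⊥) (hmono : StrictMono N)
    (hfd : ∀ k, FiniteDimensional ℂ (N k)) (hsup : (⨆ k, N k).topologicalClosure = ⊤)
    {m : ℕ → ℕ} {e : (Σ k, Fin (m k)) → H}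
    (he : Adapted N e) : ⊤ ≤ (Submodule.span ℂ (Set.range e)).topologicalClosure := by
  rw [← hsup]
  refine Submodule.topologicalClosure_mono (iSup_le fun k => ?_)
  rw [he.le_span hbot hmono hfd k]
  exact Submodule.span_mono (Set.image_subset_range _ _)

theorem Adapted.mem_iff {N : ℕ → Submodule ℂ H} (hbot : N 0 = ⊥) (hmono : StrictMono N)
    (hfd : ∀ k, FiniteDimensional ℂ (N k)) (hsup : (⨆ k, N k).topologicalClosure = ⊤)
    {m : ℕ → ℕ} {e : (Σ k, Fin (m k)) → H}
    (he : Adapted N e) (k : ℕ) (x : H) (hx : ∀ i, k ≤ i.1 → ⟪e i, x⟫_ℂ = 0) : x ∈ N k := by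
  have := hfd k
  have h0 : x - (N k).starProjection x ∈ (N k)ᗮ := Submodule.sub_starProjection_mem_orthogonal x
  have hP : (N k).starProjection x ∈ N k := Submodule.starProjection_apply_mem _ _
  have h1 : x - (N k).starProjection x ∈ (Submodule.span ℂ (Set.range e))ᗮ := by
    rw [Submodule.mem_orthogonal]
    intro u hu
    induction hu using Submodule.span_induction with
    | mem u hu =>
      obtain ⟨i, rfl⟩ := hu
      by_cases hi : k ≤ i.1
      · rw [inner_sub_right, hx i hi, zero_sub, neg_eq_zero]
        have h2 : e i ∈ (N k)ᗮ := Submodule.orthogonal_le (hmono.monotone hi) (he.mem i).2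
        exact inner_eq_zero_symm.1 ((Submodule.mem_orthogonal _ _).1 h2 _ hP)
      · exact (Submodule.mem_orthogonal _ _).1 h0 _
          (hmono.monotone (by omega : i.1 + 1 ≤ k) (he.mem i).1)
    | zero => simp
    | add u v _ _ h1 h2 => rw [inner_add_left, h1, h2, add_zero]
    | smul c u _ h => rw [inner_smul_left, h, mul_zero]
  rw [← Submodule.orthogonal_closure, top_le_iff.1 (he.dense hbot hmono hfd hsup)] at h1
  simp only [Submodule.top_orthogonal_eq_bot, Submodule.mem_bot] at h1
  rw [sub_eq_zero.1 h1]; exact hP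

theorem Adapted.mem_alg {N : ℕ → Submodule ℂ H} (hbot : N 0 = ⊥) (hmono : StrictMono N)
    (hfd : ∀ k, FiniteDimensional ℂ (N k)) 
    {m : ℕ → ℕ} {e : (Σ k, Fin (m k)) → H}
    (he : Adapted N e) (T : H →L[ℂ] H) (hT : ∀ i, T (e i) ∈ N (i.1 + 1)) :
    T ∈ nestAlgebra (insert ⊤ (Set.range N)) := by
  rintro M hM x hx
  rcases hM with rfl | ⟨k, rfl⟩
  · trivial
  · rw [he.le_span hbot hmono hfd k] at hx
    induction hx using Submodule.span_induction with
    | mem u hu =>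
      obtain ⟨i, hi, rfl⟩ := hu
      exact hmono.monotone (Nat.succ_le_of_lt hi) (hT i)
    | zero => simp
    | add u v _ _ h1 h2 => rw [map_add]; exact add_mem h1 h2
    | smul c u _ h => rw [map_smul]; exact Submodule.smul_mem _ _ h

/-- Isometry determined by the values on a Hilbert basis. -/
theorem exists_isometry [CompleteSpace H] {G : Type*} [NormedAddCommGroup G]
    [InnerProductSpace ℂ G] [CompleteSpace G] {ι : Type*} {e : ι → H} (he : Orthonormal ℂ e)
    (hd : ⊤ ≤ (Submodule.span ℂ (Set.range e)).topologicalClosure) {f : ι → G}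
    (hf : Orthonormal ℂ f) : ∃ W : H →ₗᵢ[ℂ] G, ∀ i, W (e i) = f i := by
  classical
  let b := HilbertBasis.mk he hd
  refine ⟨hf.orthogonalFamily.linearIsometry.comp b.repr.toLinearIsometry, fun i => ?_⟩
  have : e i = b i := by simp [b]
  rw [this]
  simp [HilbertBasis.repr_self, OrthogonalFamily.linearIsometry_apply_single]

theorem exists_adapted {N : ℕ → Submodule ℂ H} (hmono : StrictMono N)
    (hfd : ∀ k, FiniteDimensional ℂ (N k)) :
    ∃ e : (Σ k, Fin (Module.finrank ℂ (atomE N k))) → H, Adapted N e := by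
  have : ∀ k, FiniteDimensional ℂ (atomE N k) := fun k =>
    have := hfd (k + 1)
    Submodule.finiteDimensional_of_le (inf_le_left : atomE N k ≤ N (k + 1))
  refine ⟨_, adapted_of hmono (fun k i => (stdOrthonormalBasis ℂ (atomE N k) i : H)) ?_ ?_⟩
  · intro k
    exact (stdOrthonormalBasis ℂ (atomE N k)).orthonormal.comp_linearIsometry
      (atomE N k).subtypeₗᵢ
  · intro k
    have h := (stdOrthonormalBasis ℂ (atomE N k)).toBasis.span_eq
    have h2 := congrArg (Submodule.map (atomE N k).subtype) h
    rw [Submodule.map_span, Submodule.map_top, Submodule.range_subtype, ← Set.range_comp] at h2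
    simpa [Function.comp_def] using h2

theorem finrank_atom {N : ℕ → Submodule ℂ H} (hmono : StrictMono N)
    (hfd : ∀ k, FiniteDimensional ℂ (N k)) (k : ℕ) :
    Module.finrank ℂ (N k) + Module.finrank ℂ (atomE N k) = Module.finrank ℂ (N (k + 1)) := by
  have := hfd (k + 1)
  have h := Submodule.finrank_add_inf_finrank_orthogonal (hmono.monotone (Nat.le_succ k))
  rw [inf_comm] at h
  exact h

theorem left_not_dense [CompleteSpace H] {N : ℕ → Submodule ℂ H} (hbot : N 0 = ⊥)
    (hmono : StrictMono N)
    (hfd : ∀ k, FiniteDimensional ℂ (N k)) (hsup : (⨆ k, N k).topologicalClosure = ⊤) (n : ℕ) :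
    ¬ Dense (Lg (nestAlgebra (insert ⊤ (Set.range N))) n) := by
  classical
  intro hdense
  obtain ⟨e, he⟩ := exists_adapted hmono hfd
  have hpos : ∀ k, 0 < Module.finrank ℂ (atomE N k) := by
    intro k
    have := hfd (k + 1)
    have h1 := finrank_atom hmono hfd k
    have h2 := Submodule.finrank_lt_finrank_of_lt (hmono (Nat.lt_succ_self k))
    simp only [Nat.succ_eq_add_one] at h2
    omega
  let ι := (Σ k, Fin (Module.finrank ℂ (atomE N k)))
  let z : ℕ → ι := fun k => ⟨k, ⟨0, hpos k⟩⟩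
  have hz : ∀ {k l}, z k = z l → k = l := fun {k l} h => congrArg Sigma.fst h
  let code : Fin n → ι → ℕ := fun j i => Nat.pair i.1 (Encodable.encode (j, i))
  have hcode : ∀ {j i j' i'}, code j i = code j' i' → j = j' ∧ i = i' := by
    intro j i j' i' h
    have h2 := (Nat.pair_eq_pair.1 h).2
    have h3 := Encodable.encode_injective h2
    exact ⟨congrArg Prod.fst h3, congrArg Prod.snd h3⟩
  have hlev : ∀ j i, i.1 ≤ code j i := fun j i => Nat.left_le_pair _ _
  have hd := he.dense hbot hmono hfd hsup
  have hS : ∀ j : Fin n, ∃ W : H →ₗᵢ[ℂ] H, ∀ i, W (e i) = e (z (code j i + 1)) := by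
    intro j
    apply exists_isometry he.on hd
    refine he.on.comp (fun i => z (code j i + 1)) (fun i i' h => ?_)
    exact (hcode (Nat.succ_injective (hz h))).2
  choose S hS using hS
  let Sc : Fin n → H →L[ℂ] H := fun j => (S j).toContinuousLinearMap
  have hSc : ∀ j i, Sc j (e i) = e (z (code j i + 1)) := fun j i => hS j i
  let ad : Fin n → H →L[ℂ] H := fun j => ContinuousLinearMap.adjoint (Sc j)
  have had : ∀ j, ad j ∈ nestAlgebra (insert ⊤ (Set.range N)) := by
    intro j
    refine he.mem_alg hbot hmono hfd _ fun l => ?_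
    refine he.mem_iff hbot hmono hfd hsup _ _ fun i hi => ?_
    rw [ContinuousLinearMap.adjoint_inner_right, hSc]
    apply he.on.2
    intro h
    have := hlev j i
    have h2 : code j i + 1 = l.1 := congrArg Sigma.fst h
    omega
  -- orthogonality relations, by density
  have hext : ∀ T U : H →L[ℂ] H, (∀ i, T (e i) = U (e i)) → T = U := by
    intro T U h
    refine ContinuousLinearMap.ext_on (s := Set.range e) ?_ ?_
    · have := top_le_iff.1 hd
      exact (Submodule.dense_iff_topologicalClosure_eq_top).2 this
    · rintro _ ⟨i, rfl⟩; exact h i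
  have horth : ∀ j l, (ad j) ∘L (Sc l) = if j = l then 1 else 0 := by
    intro j l
    apply hext
    intro i
    have hin : ∀ i', ⟪e i', ((ad j) ∘L (Sc l)) (e i)⟫_ℂ
        = ⟪e i', (if j = l then (1 : H →L[ℂ] H) else 0) (e i)⟫_ℂ := by
      intro i'
      have hon := orthonormal_iff_ite.1 he.on
      rw [ContinuousLinearMap.comp_apply, ContinuousLinearMap.adjoint_inner_right, hSc, hSc]
      rw [hon]
      have hiff : z (code j i' + 1) = z (code l i + 1) ↔ j = l ∧ i' = i := by
        constructor
        · intro h; exact hcode (Nat.succ_injective (hz h))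
        · rintro ⟨rfl, rfl⟩; rfl
      simp only [hiff]
      by_cases h : j = l
      · simp [h, hon]
      · simp [h]
    let b := HilbertBasis.mk he.on hd
    apply b.repr.injective
    ext i'
    rw [b.repr_apply_apply, b.repr_apply_apply]
    simpa [b] using hin i'
  have hz0 : ∀ j x, ⟪e (z 0), Sc j x⟫_ℂ = 0 := by
    intro j
    have : (ad j) (e (z 0)) = 0 := by
      let b := HilbertBasis.mk he.on hd
      apply b.repr.injective
      ext i'
      rw [b.repr_apply_apply, b.repr_apply_apply]
      simp only [b, HilbertBasis.coe_mk, inner_zero_right]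
      rw [ContinuousLinearMap.adjoint_inner_right, hSc]
      apply he.on.2
      intro h
      have := hz h
      omega
    intro x
    rw [← ContinuousLinearMap.adjoint_inner_left]
    change ⟪(ad j) (e (z 0)), x⟫_ℂ = 0
    rw [this, inner_zero_left]
  let a : Fin n → nestAlgebra (insert ⊤ (Set.range N)) := fun j => ⟨ad j, had j⟩
  have hδ : (0:ℝ) < 1 / (n + 1) := by positivity
  obtain ⟨a', ha', hdist⟩ := Metric.dense_iff.1 hdense a _ hδ
  obtain ⟨b, hb⟩ := hdist
  let a'' : Fin n → H →L[ℂ] H := fun j => (a' j : H →L[ℂ] H)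
  have hclose : ∀ j, ‖ad j - a'' j‖ ≤ 1 / (n + 1) := by
    intro j
    have h1 := (dist_pi_lt_iff hδ).1 (Metric.mem_ball.1 ha') j
    rw [dist_comm, dist_eq_norm] at h1
    exact h1.le
  let A' : H →L[ℂ] (Fin n → H) := ContinuousLinearMap.pi a''
  let R : (Fin n → H) →L[ℂ] H := ∑ l, (Sc l) ∘L (ContinuousLinearMap.proj l)
  have hR : ∀ y, R y = ∑ l, Sc l (y l) := by intro y; simp [R]
  have hadR : ∀ j y, ad j (R y) = y j := by
    intro j y
    rw [hR, map_sum]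
    have : ∀ l, ad j (Sc l (y l)) = if j = l then y l else 0 := by
      intro l
      have := congrArg (fun T : H →L[ℂ] H => T (y l)) (horth j l)
      simp only [ContinuousLinearMap.comp_apply] at this
      rw [this]; split_ifs <;> simp
    simp [this]
  have hRn : ∀ y, ‖R y‖ ≤ n * ‖y‖ := by
    intro y
    rw [hR]
    refine (norm_sum_le _ _).trans ?_
    calc ∑ l, ‖Sc l (y l)‖ ≤ ∑ l : Fin n, ‖y‖ := by
          refine Finset.sum_le_sum fun l _ => ?_
          have : ‖Sc l (y l)‖ = ‖y l‖ := (S l).norm_map _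
          rw [this]; exact norm_le_pi_norm y l
      _ = n * ‖y‖ := by simp
  have hunit : IsUnit (A' ∘L R) := by
    have h1 : ‖(1 - A' ∘L R : (Fin n → H) →L[ℂ] (Fin n → H))‖ < 1 := by
      refine lt_of_le_of_lt (ContinuousLinearMap.opNorm_le_bound _
        (by positivity : (0:ℝ) ≤ 1 / (n + 1) * n) fun y => ?_) ?_
      · rw [pi_norm_le_iff_of_nonneg (by positivity)]
        intro j
        have : ((1 - A' ∘L R : (Fin n → H) →L[ℂ] (Fin n → H)) y) j = (ad j - a'' j) (R y) := by
          simp [A', hadR]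
        rw [this]
        calc _ ≤ ‖ad j - a'' j‖ * ‖R y‖ := ContinuousLinearMap.le_opNorm _ _
          _ ≤ (1 / (n + 1)) * (n * ‖y‖) := by
            gcongr
            · exact hclose j
            · exact hRn y
          _ = _ := by ring
      · rw [one_div, inv_mul_lt_iff₀ (by positivity)]; linarith
    have h2 := isUnit_one_sub_of_norm_lt_one (R := (Fin n → H) →L[ℂ] (Fin n → H)) h1
    rwa [sub_sub_cancel] at h2
  obtain ⟨⟨u, v, huv, hvu⟩, hu⟩ := hunit
  simp only at hu
  subst hu
  let y := v (A' (e (z 0)))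
  have hy : A' (R y) = A' (e (z 0)) := 
    congrArg (fun T : (Fin n → H) →L[ℂ] (Fin n → H) => T (A' (e (z 0)))) huv
  have hb' : ∀ x, ∑ j, (b j : H →L[ℂ] H) (a'' j x) = x := by
    intro x
    have := congrArg (fun T : nestAlgebra (insert ⊤ (Set.range N)) => (T : H →L[ℂ] H) x) hb
    simpa [a''] using this
  have heq : R y = e (z 0) := by
    rw [← hb' (R y), ← hb' (e (z 0))]
    refine Finset.sum_congr rfl fun j _ => ?_
    exact congrArg _ (congrFun hy j)
  have h1 : ⟪e (z 0), R y⟫_ℂ = 0 := by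
    rw [hR, inner_sum]
    exact Finset.sum_eq_zero fun j _ => hz0 j _
  rw [heq, inner_self_eq_zero] at h1
  have := he.on.1 (z 0)
  rw [h1] at this
  simp at this

theorem right_sub_left {N : ℕ → Submodule ℂ H}
    (hfd : ∀ k, FiniteDimensional ℂ (N k)) (hsup : (⨆ k, N k).topologicalClosure = ⊤) 
    (hmono : StrictMono N) :
    Rg (nestAlgebra (insert ⊤ (Set.range N))) 1 ⊆ Lg (nestAlgebra (insert ⊤ (Set.range N))) 1 := by
  rintro a ⟨b, hb⟩
  refine ⟨b, ?_⟩
  simp only [Fin.sum_univ_one] at hb ⊢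
  generalize a 0 = a at *
  generalize b 0 = b at *
  have hab : ∀ x, (a : H →L[ℂ] H) ((b : H →L[ℂ] H) x) = x := fun x =>
    congrArg (fun T : nestAlgebra (insert ⊤ (Set.range N)) => (T : H →L[ℂ] H) x) hb
  apply Subtype.ext
  refine ContinuousLinearMap.ext_on (s := ((⨆ k, N k : Submodule ℂ H) : Set H)) ?_ ?_
  · rw [Submodule.span_eq]
    exact (Submodule.dense_iff_topologicalClosure_eq_top).2 hsup
  · intro x hx
    obtain ⟨k, hk⟩ := (Submodule.mem_iSup_of_directed _ hmono.monotone.directed_le).1 hx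
    have := hfd k
    have hA : ∀ x ∈ N k, (a : H →L[ℂ] H).toLinearMap x ∈ N k := a.2 (N k) (Or.inr ⟨k, rfl⟩)
    have hB : ∀ x ∈ N k, (b : H →L[ℂ] H).toLinearMap x ∈ N k := b.2 (N k) (Or.inr ⟨k, rfl⟩)
    let A := (a : H →L[ℂ] H).toLinearMap.restrict hA
    let B := (b : H →L[ℂ] H).toLinearMap.restrict hB
    have h1 : A * B = 1 := by
      ext y
      exact hab y
    have h2 : B * A = 1 := mul_eq_one_comm.1 h1
    exact congrArg (fun T : N k →ₗ[ℂ] N k => (T ⟨x, hk⟩ : H)) h2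

theorem svd_abs {E K : Type*} [NormedAddCommGroup E] [InnerProductSpace ℂ E]
    [NormedAddCommGroup K] [InnerProductSpace ℂ K] [FiniteDimensional ℂ E]
    [FiniteDimensional ℂ K] (M : K →ₗ[ℂ] E)
    (hdim : Module.finrank ℂ E ≤ Module.finrank ℂ K) :
    ∃ (e : OrthonormalBasis (Fin (Module.finrank ℂ E)) ℂ E)
      (f : Fin (Module.finrank ℂ E) → K) (s : Fin (Module.finrank ℂ E) → ℝ),
      Orthonormal ℂ f ∧ (∀ i, 0 ≤ s i) ∧ ∀ i, M (f i) = (s i : ℂ) • e i := by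
  classical
  set m := Module.finrank ℂ E with hm
  let Md := LinearMap.adjoint M
  have hsymm : (M ∘ₗ Md).IsSymmetric := by
    intro x y
    simp only [LinearMap.comp_apply, Md]
    rw [← LinearMap.adjoint_inner_right, LinearMap.adjoint_inner_left]
  let e := hsymm.eigenvectorBasis hm.symm
  let lam := hsymm.eigenvalues hm.symm
  have hlam : ∀ i, M (Md (e i)) = (lam i : ℂ) • e i := fun i =>
    hsymm.apply_eigenvectorBasis hm.symm i
  have hin : ∀ i j, ⟪Md (e i), Md (e j)⟫_ℂ = if i = j then (lam i : ℂ) else 0 := by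
    intro i j
    have : ⟪Md (e i), Md (e j)⟫_ℂ = ⟪e i, M (Md (e j))⟫_ℂ := LinearMap.adjoint_inner_left _ _ _
    rw [this, hlam, inner_smul_right, orthonormal_iff_ite.1 e.orthonormal]
    split_ifs with h
    · simp [h]
    · simp
  have hnn : ∀ i, 0 ≤ lam i := by
    intro i
    have h := hin i i
    rw [if_pos rfl, inner_self_eq_norm_sq_to_K] at h
    have h2 : ‖Md (e i)‖ ^ 2 = lam i := Complex.ofReal_injective (by simpa using h)
    rw [← h2]; positivity
  let c : Fin m → Fin (Module.finrank ℂ K) := Fin.castLE hdim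
  have hc : Function.Injective c := Fin.castLE_injective hdim
  let v : Fin (Module.finrank ℂ K) → K :=
    Function.extend c (fun i => ((Real.sqrt (lam i))⁻¹ : ℂ) • Md (e i)) 0
  have hv : ∀ i, v (c i) = ((Real.sqrt (lam i))⁻¹ : ℂ) • Md (e i) := fun i =>
    hc.extend_apply _ _ i
  let S : Set (Fin (Module.finrank ℂ K)) := {q | ∃ i, c i = q ∧ lam i ≠ 0}
  have hon : Orthonormal ℂ (S.domRestrict v) := by
    rw [orthonormal_iff_ite]
    rintro ⟨_, i, rfl, hi⟩ ⟨_, j, rfl, hj⟩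
    simp only [Set.domRestrict_apply, hv, inner_smul_left, inner_smul_right, hin, Subtype.mk.injEq,
      hc.eq_iff]
    split_ifs with h
    · subst h
      have h1 : (Real.sqrt (lam i) : ℂ) * (Real.sqrt (lam i) : ℂ) = lam i := by
        exact_mod_cast Real.mul_self_sqrt (hnn i)
      have h2 : (Real.sqrt (lam i) : ℂ) ≠ 0 := by
        exact_mod_cast (Real.sqrt_ne_zero (hnn i)).2 hi
      simp only [map_inv₀, Complex.conj_ofReal]
      rw [← h1]
      field_simp
    · simp
  obtain ⟨b, hb⟩ := hon.exists_orthonormalBasis_extension_of_card_eq (by simp)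
  refine ⟨e, fun i => b (c i), fun i => Real.sqrt (lam i), b.orthonormal.comp c hc,
    fun i => Real.sqrt_nonneg _, fun i => ?_⟩
  beta_reduce
  by_cases hi : lam i = 0
  · rw [hi, Real.sqrt_zero, Complex.ofReal_zero, zero_smul]
    refine InnerProductSpace.ext_inner_left_basis e.toBasis ?_
    intro j
    rw [inner_zero_right, OrthonormalBasis.coe_toBasis, ← LinearMap.adjoint_inner_left]
    change ⟪Md (e j), b (c i)⟫_ℂ = 0
    by_cases hj : lam j = 0
    · have h := hin j j
      rw [if_pos rfl, hj, Complex.ofReal_zero, inner_self_eq_zero] at h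
      rw [h, inner_zero_left]
    · have h1 : b (c j) = _ := (hb (c j) ⟨j, rfl, hj⟩).trans (hv j)
      have h2 : (Real.sqrt (lam j) : ℂ) ≠ 0 := by
        exact_mod_cast (Real.sqrt_ne_zero (hnn j)).2 hj
      have h3 : Md (e j) = (Real.sqrt (lam j) : ℂ) • b (c j) := by
        rw [h1, smul_smul, mul_inv_cancel₀ h2, one_smul]
      rw [h3, inner_smul_left, b.orthonormal.2, mul_zero]
      intro h
      have := hc h
      subst this
      exact hj hi
  · have h2 : (Real.sqrt (lam i) : ℂ) ≠ 0 := by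
      exact_mod_cast (Real.sqrt_ne_zero (hnn i)).2 hi
    have h1 : (Real.sqrt (lam i) : ℂ) * (Real.sqrt (lam i) : ℂ) = lam i := by
      exact_mod_cast Real.mul_self_sqrt (hnn i)
    rw [hb (c i) ⟨i, rfl, hi⟩, hv, map_smul, hlam, smul_smul, ← h1]
    congr 1
    field_simp

theorem svd_local {G : Type*} [NormedAddCommGroup G] [InnerProductSpace ℂ G]
    (A : G →ₗ[ℂ] H) (E : Submodule ℂ H) (K : Submodule ℂ G) [FiniteDimensional ℂ E]
    [FiniteDimensional ℂ K] (hAK : ∀ x ∈ K, A x ∈ E)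
    (hdim : Module.finrank ℂ E ≤ Module.finrank ℂ K) :
    ∃ (e : Fin (Module.finrank ℂ E) → H)
      (f : Fin (Module.finrank ℂ E) → G) (s : Fin (Module.finrank ℂ E) → ℝ),
      Orthonormal ℂ e ∧ Submodule.span ℂ (Set.range e) = E ∧ Orthonormal ℂ f ∧
      (∀ i, f i ∈ K) ∧ (∀ i, 0 ≤ s i) ∧ ∀ i, A (f i) = (s i : ℂ) • e i := by
  obtain ⟨e, f, s, hf, hs, h⟩ := svd_abs (A.restrict hAK) hdim
  refine ⟨fun i => e i, fun i => f i, s, e.orthonormal.comp_linearIsometry E.subtypeₗᵢ, ?_,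
    hf.comp_linearIsometry K.subtypeₗᵢ, fun i => (f i).2, hs,
    fun i => congrArg Subtype.val (h i)⟩
  have h := e.toBasis.span_eq
  have h2 := congrArg (Submodule.map E.subtype) h
  rw [Submodule.map_span, Submodule.map_top, Submodule.range_subtype, ← Set.range_comp] at h2
  simpa [Function.comp_def] using h2

/-- A bounded operator that is diagonal in an orthonormal basis with entries at least `ε`
is invertible. -/
theorem diag_unit [CompleteSpace H] {ι : Type*} {e : ι → H} (he : Orthonormal ℂ e)
    (hd : ⊤ ≤ (Submodule.span ℂ (Set.range e)).topologicalClosure) (T : H →L[ℂ] H)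
    (t : ι → ℝ) (ε : ℝ) (hε : 0 < ε) (ht : ∀ i, ε ≤ t i) (hT : ∀ i, T (e i) = (t i : ℂ) • e i) :
    IsUnit T := by
  classical
  let b := HilbertBasis.mk he hd
  have hbe : ∀ i, b i = e i := fun i => by simp [b]
  have hdense : Dense (Submodule.span ℂ (Set.range e) : Set H) :=
    (Submodule.dense_iff_topologicalClosure_eq_top).2 (top_le_iff.1 hd)
  have hin : ∀ i x, ⟪e i, T x⟫_ℂ = t i * ⟪e i, x⟫_ℂ := by
    intro i x
    have : (innerSL ℂ (e i)) ∘L T = (t i : ℂ) • innerSL ℂ (e i) := by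
      refine ContinuousLinearMap.ext_on hdense ?_
      rintro _ ⟨j, rfl⟩
      simp only [ContinuousLinearMap.comp_apply, innerSL_apply_apply, hT, inner_smul_right,
        smul_apply, smul_eq_mul, orthonormal_iff_ite.1 he]
      split_ifs with h
      · rw [h]
      · simp
    simpa using congrArg (fun S : H →L[ℂ] ℂ => S x) this
  have hnorm : ∀ x, HasSum (fun i => ‖⟪e i, x⟫_ℂ‖ ^ 2) (‖x‖ ^ 2) := by
    intro x
    have h := b.hasSum_inner_mul_inner x x
    rw [inner_self_eq_norm_sq_to_K] at h
    have h2 := Complex.hasSum_re h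
    convert h2 using 1
    · ext i
      rw [hbe, ← inner_conj_symm x (e i), mul_comm, Complex.mul_conj, Complex.ofReal_re,
        Complex.normSq_eq_norm_sq]
    · norm_cast
  have hlow : ∀ x, ε * ‖x‖ ≤ ‖T x‖ := by
    intro x
    have h : ε ^ 2 * ‖x‖ ^ 2 ≤ ‖T x‖ ^ 2 := by
      refine hasSum_le (fun i => ?_) ((hnorm x).mul_left (ε ^ 2)) (hnorm (T x))
      rw [hin, norm_mul, mul_pow]
      gcongr
      rw [Complex.norm_real]
      exact (ht i).trans (le_abs_self _)
    rw [← mul_pow] at h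
    exact le_of_sq_le_sq h (norm_nonneg _)
  rw [ContinuousLinearMap.isUnit_iff_bijective,
    ContinuousLinearMap.bijective_iff_dense_range_and_antilipschitz]
  constructor
  · rw [← top_le_iff]
    refine hd.trans (Submodule.topologicalClosure_mono ?_)
    rw [Submodule.span_le]
    rintro _ ⟨i, rfl⟩
    have : (t i : ℂ) ≠ 0 := by exact_mod_cast (hε.trans_le (ht i)).ne'
    exact ⟨(t i : ℂ)⁻¹ • e i, by
      rw [ContinuousLinearMap.coe_coe, map_smul, hT, smul_smul, inv_mul_cancel₀ this, one_smul]⟩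
  · refine ⟨⟨ε⁻¹, by positivity⟩, T.antilipschitz_of_bound fun x => ?_⟩
    change ‖x‖ ≤ ε⁻¹ * ‖T x‖
    rw [le_inv_mul_iff₀ hε]
    exact hlow x

theorem right_dense [CompleteSpace H] {N : ℕ → Submodule ℂ H} (hbot : N 0 = ⊥)
    (hmono : StrictMono N)
    (hfd : ∀ k, FiniteDimensional ℂ (N k)) (hsup : (⨆ k, N k).topologicalClosure = ⊤)
    (hdim : ∀ k, Module.finrank ℂ (N k) ≤ Module.finrank ℂ (atomE N k)) :
    Dense (Rg (nestAlgebra (insert ⊤ (Set.range N))) 2) := by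
  classical
  rw [Metric.dense_iff]
  intro a r hr
  let ε : ℝ := r / 2
  have hε : 0 < ε := half_pos hr
  let G := WithLp 2 (H × H)
  let a1 : H →L[ℂ] H := (a 0 : H →L[ℂ] H)
  let a2 : H →L[ℂ] H := (a 1 : H →L[ℂ] H)
  let p1 : G →L[ℂ] H := WithLp.fstL 2 ℂ H H
  let p2 : G →L[ℂ] H := WithLp.sndL 2 ℂ H H
  let A : G →L[ℂ] H := a1 ∘L p1 + a2 ∘L p2
  have hAN : ∀ k x, p1 x ∈ N k → p2 x ∈ N k → A x ∈ N k := fun k x h1 h2 =>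
    add_mem ((a 0).2 (N k) (Or.inr ⟨k, rfl⟩) _ h1) ((a 1).2 (N k) (Or.inr ⟨k, rfl⟩) _ h2)
  have hE : ∀ k, FiniteDimensional ℂ (atomE N k) := fun k =>
    have := hfd (k + 1)
    Submodule.finiteDimensional_of_le (inf_le_left : atomE N k ≤ N (k + 1))
  have hloc : ∀ k, ∃ K : Submodule ℂ G, FiniteDimensional ℂ K ∧
      (∀ x ∈ K, p1 x ∈ atomE N k ∧ p2 x ∈ atomE N k ∧ A x ∈ atomE N k) ∧
      Module.finrank ℂ (atomE N k) ≤ Module.finrank ℂ K := by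
    intro k
    have := hfd k
    have := hE k
    let J : (atomE N k × atomE N k) →ₗ[ℂ] G :=
      (WithLp.linearEquiv 2 ℂ (H × H)).symm.toLinearMap ∘ₗ
        ((atomE N k).subtype.prodMap (atomE N k).subtype)
    have hJ : Function.Injective J := by
      refine (WithLp.linearEquiv 2 ℂ (H × H)).symm.injective.comp ?_
      exact Function.Injective.prodMap Subtype.val_injective Subtype.val_injective
    let Q : (atomE N k × atomE N k) →ₗ[ℂ] N k :=
      (N k).orthogonalProjectionOnto.toLinearMap ∘ₗ A.toLinearMap ∘ₗ J
    refine ⟨(LinearMap.ker Q).map J, inferInstance, ?_, ?_⟩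
    · rintro _ ⟨⟨x, y⟩, hxy, rfl⟩
      refine ⟨x.2, y.2, hAN (k + 1) _ x.2.1 y.2.1, ?_⟩
      have : (N k).orthogonalProjectionOnto (A (J (x, y))) = 0 := hxy
      exact Submodule.orthogonalProjectionOnto_eq_zero_iff.1 this
    · have h1 : Module.finrank ℂ ((LinearMap.ker Q).map J) = Module.finrank ℂ (LinearMap.ker Q) :=
        (Submodule.equivMapOfInjective J hJ (LinearMap.ker Q)).finrank_eq.symm
      have h2 := LinearMap.finrank_range_add_finrank_ker Q
      have h3 := Submodule.finrank_le (LinearMap.range Q)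
      have h4 := hdim k
      rw [Module.finrank_prod] at h2
      omega
  choose K hKfd hK hKdim using hloc
  have hsvd := fun k => svd_local A.toLinearMap (atomE N k) (K k)
    (fun x hx => (hK k x hx).2.2) (hKdim k)
  choose e f s he1 he2 hf1 hf2 hs hA using hsvd
  have hF1 : ∀ k i, p1 (f k i) ∈ atomE N k := fun k i => (hK k _ (hf2 k i)).1
  have hF2 : ∀ k i, p2 (f k i) ∈ atomE N k := fun k i => (hK k _ (hf2 k i)).2.1
  have hperp : ∀ k l, k < l → ∀ x y, x ∈ atomE N k → y ∈ atomE N l → ⟪x, y⟫_ℂ = 0 := by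
    intro k l hkl x y hx hy
    exact (Submodule.mem_orthogonal _ _).1 hy.2 _
        (hmono.monotone (Nat.succ_le_of_lt hkl) hx.1)
  have hinner : ∀ x y : G, ⟪x, y⟫_ℂ = ⟪p1 x, p1 y⟫_ℂ + ⟪p2 x, p2 y⟫_ℂ := fun x y =>
    WithLp.prod_inner_apply x y
  let ι := Σ k, Fin (Module.finrank ℂ (atomE N k))
  let e' : ι → H := fun i => e i.1 i.2
  let F : ι → G := fun i => f i.1 i.2
  have had : Adapted N e' := adapted_of hmono e he1 he2
  have hd := had.dense hbot hmono hfd hsup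
  have hF : Orthonormal ℂ F := by
    have key : ∀ k l, k < l → ∀ i j, ⟪f k i, f l j⟫_ℂ = 0 := by
      intro k l hkl i j
      rw [hinner, hperp k l hkl _ _ (hF1 k i) (hF1 l j), hperp k l hkl _ _ (hF2 k i) (hF2 l j),
        add_zero]
    refine ⟨fun i => (hf1 i.1).1 i.2, ?_⟩
    rintro ⟨k, i⟩ ⟨l, j⟩ hne
    rcases lt_trichotomy k l with h | h | h
    · exact key k l h i j
    · subst h
      exact (hf1 k).2 (fun h : i = j => hne (by rw [h]))
    · exact inner_eq_zero_symm.1 (key l k h j i)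
  obtain ⟨W, hW⟩ := exists_isometry had.on hd hF
  let Wc : H →L[ℂ] G := W.toContinuousLinearMap
  have hWc : ∀ i, Wc (e' i) = F i := hW
  let w1 : H →L[ℂ] H := p1 ∘L Wc
  let w2 : H →L[ℂ] H := p2 ∘L Wc
  have hw1 : ∀ i, w1 (e' i) ∈ atomE N i.1 := fun i => by
    change p1 (Wc (e' i)) ∈ _
    rw [hWc]; exact hF1 _ _
  have hw2 : ∀ i, w2 (e' i) ∈ atomE N i.1 := fun i => by
    change p2 (Wc (e' i)) ∈ _
    rw [hWc]; exact hF2 _ _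
  have halg : ∀ w : H →L[ℂ] H, (∀ i, w (e' i) ∈ atomE N i.1) →
      w ∈ nestAlgebra (insert ⊤ (Set.range N)) := fun w hw =>
    had.mem_alg hbot hmono hfd w fun i => (hw i).1
  have halgd : ∀ w : H →L[ℂ] H, (∀ i, w (e' i) ∈ atomE N i.1) →
      ContinuousLinearMap.adjoint w ∈ nestAlgebra (insert ⊤ (Set.range N)) := by
    intro w hw
    refine had.mem_alg hbot hmono hfd _ fun l => ?_
    refine had.mem_iff hbot hmono hfd hsup _ _ fun i hi => ?_
    rw [ContinuousLinearMap.adjoint_inner_right]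
    exact inner_eq_zero_symm.1 (hperp l.1 i.1 (by omega) _ _ (had.mem l) (hw i))
  have hww : ∀ x, ContinuousLinearMap.adjoint w1 (w1 x) + ContinuousLinearMap.adjoint w2 (w2 x)
      = x := by
    intro x
    refine ext_inner_right ℂ fun y => ?_
    rw [inner_add_left, ContinuousLinearMap.adjoint_inner_left,
      ContinuousLinearMap.adjoint_inner_left]
    exact (hinner (W x) (W y)).symm.trans (W.inner_map_map x y)
  let T : H →L[ℂ] H := A ∘L Wc + (ε : ℂ) • 1
  have hT : ∀ i, T (e' i) = ((s i.1 i.2 + ε : ℝ) : ℂ) • e' i := by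
    intro i
    have h1 : A (F i) = (s i.1 i.2 : ℂ) • e' i := hA i.1 i.2
    change A (Wc (e' i)) + (ε : ℂ) • e' i = _
    rw [hWc, h1, ← add_smul, Complex.ofReal_add]
  obtain ⟨⟨u, v, huv, hvu⟩, hu⟩ := diag_unit had.on hd T (fun i => s i.1 i.2 + ε) ε hε
    (fun i => by have := hs i.1 i.2; linarith) hT
  simp only at hu
  subst hu
  have hv : v ∈ nestAlgebra (insert ⊤ (Set.range N)) := by
    refine had.mem_alg hbot hmono hfd _ fun i => ?_
    have h1 : v (T (e' i)) = e' i := congrArg (fun S : H →L[ℂ] H => S (e' i)) hvu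
    have hne : ((s i.1 i.2 + ε : ℝ) : ℂ) ≠ 0 := by
      have := hs i.1 i.2
      exact_mod_cast (by linarith : 0 < s i.1 i.2 + ε).ne'
    rw [hT, map_smul] at h1
    have h2 : v (e' i) = ((s i.1 i.2 + ε : ℝ) : ℂ)⁻¹ • e' i := by
      nth_rewrite 2 [← h1]
      rw [smul_smul, inv_mul_cancel₀ hne, one_smul]
    rw [h2]
    exact Submodule.smul_mem _ _ (had.mem i).1
  let c1 : nestAlgebra (insert ⊤ (Set.range N)) := ⟨_, halgd w1 hw1⟩
  let c2 : nestAlgebra (insert ⊤ (Set.range N)) := ⟨_, halgd w2 hw2⟩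
  let d1 : nestAlgebra (insert ⊤ (Set.range N)) := ⟨_, halg w1 hw1⟩
  let d2 : nestAlgebra (insert ⊤ (Set.range N)) := ⟨_, halg w2 hw2⟩
  let v' : nestAlgebra (insert ⊤ (Set.range N)) := ⟨v, hv⟩
  have hn1 : ‖c1‖ ≤ 1 := by
    change ‖ContinuousLinearMap.adjoint w1‖ ≤ 1
    rw [LinearIsometryEquiv.norm_map]
    refine ContinuousLinearMap.opNorm_le_bound _ zero_le_one fun x => ?_
    rw [one_mul]
    exact (WithLp.norm_fst_le (p := 2) H (W x)).trans (W.norm_map x).le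
  have hn2 : ‖c2‖ ≤ 1 := by
    change ‖ContinuousLinearMap.adjoint w2‖ ≤ 1
    rw [LinearIsometryEquiv.norm_map]
    refine ContinuousLinearMap.opNorm_le_bound _ zero_le_one fun x => ?_
    rw [one_mul]
    exact (WithLp.norm_snd_le (p := 2) H (W x)).trans (W.norm_map x).le
  have hnε : ∀ c : nestAlgebra (insert ⊤ (Set.range N)), ‖c‖ ≤ 1 → ‖(ε : ℂ) • c‖ < r := by
    intro c hc
    have h1 : ‖(ε : ℂ) • c‖ = ε * ‖c‖ := by
      change ‖(ε : ℂ) • (c : H →L[ℂ] H)‖ = ε * ‖(c : H →L[ℂ] H)‖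
      rw [norm_smul, Complex.norm_real, Real.norm_of_nonneg hε.le]
    rw [h1]
    have : ε * ‖c‖ ≤ ε * 1 := mul_le_mul_of_nonneg_left hc hε.le
    have h3 : ε < r := half_lt_self hr
    linarith
  refine ⟨![a 0 + (ε : ℂ) • c1, a 1 + (ε : ℂ) • c2], ?_, ![d1 * v', d2 * v'], ?_⟩
  · rw [Metric.mem_ball, dist_pi_lt_iff hr]
    intro j
    fin_cases j
    · simpa [dist_eq_norm] using hnε c1 hn1
    · simpa [dist_eq_norm] using hnε c2 hn2
  · rw [Fin.sum_univ_two]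
    apply Subtype.ext
    refine ContinuousLinearMap.ext fun x => ?_
    have h1 : T (v x) = x := congrArg (fun S : H →L[ℂ] H => S x) huv
    have h2 : T (v x) = (a1 (w1 (v x)) + a2 (w2 (v x))) + (ε : ℂ) • v x := rfl
    change (a1 (w1 (v x)) + (ε : ℂ) • ContinuousLinearMap.adjoint w1 (w1 (v x)))
      + (a2 (w2 (v x)) + (ε : ℂ) • ContinuousLinearMap.adjoint w2 (w2 (v x))) = x
    rw [add_add_add_comm, ← smul_add, hww, ← h2, h1]

end aux

/-- For the nest `{0} = N₀ < N₁ < ⋯` ordered like `ℕ` with finite-dimensional atoms of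
ranks `nk k` satisfying `nk k ≥ 4 ∑_{i<k} nk i`, the left topological stable rank of the
nest algebra is infinite while its right topological stable rank is `2`; in particular
they differ. -/
theorem stmt18 {H : Type*} [NormedAddCommGroup H] [InnerProductSpace ℂ H] [CompleteSpace H]
    (N : ℕ → Submodule ℂ H) (hbot : N 0 = ⊥) (hmono : StrictMono N)
    (hfd : ∀ k, FiniteDimensional ℂ (N k)) (nk : ℕ → ℕ)
    (hrank : ∀ k, Module.finrank ℂ (N (k + 1)) = Module.finrank ℂ (N k) + nk (k + 1))
    (hgrow : ∀ k, 1 ≤ k → 4 * ∑ i ∈ Finset.Ico 1 k, nk i ≤ nk k)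
    (hsup : (⨆ k, N k).topologicalClosure = ⊤) :
    ltsr (nestAlgebra (insert ⊤ (Set.range N))) = ⊤ ∧
      rtsr (nestAlgebra (insert ⊤ (Set.range N))) = 2 ∧
      ltsr (nestAlgebra (insert ⊤ (Set.range N))) ≠
        rtsr (nestAlgebra (insert ⊤ (Set.range N))) := by
  have hL := left_not_dense hbot hmono hfd hsup
  have hl : ltsr (nestAlgebra (insert ⊤ (Set.range N))) = ⊤ := by
    rw [ltsr, sInf_eq_top]
    rintro _ ⟨n, rfl, hn⟩
    exact absurd hn (hL n)
  have hsum : ∀ k, Module.finrank ℂ (N k) = ∑ i ∈ Finset.Ico 1 (k + 1), nk i := by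
    intro k
    induction k with
    | zero => simp [hbot]
    | succ k ih => rw [hrank, ih, Finset.sum_Ico_succ_top (by omega : 1 ≤ k + 1)]
  have hdim : ∀ k, Module.finrank ℂ (N k) ≤ Module.finrank ℂ (atomE N k) := by
    intro k
    have h1 := finrank_atom hmono hfd k
    have h2 := hrank k
    have h3 := hgrow (k + 1) (by omega)
    have h4 := hsum k
    omega
  have hr : rtsr (nestAlgebra (insert ⊤ (Set.range N))) = 2 := by
    apply le_antisymm
    · exact sInf_le ⟨2, rfl, right_dense hbot hmono hfd hsup hdim⟩
    · refine le_sInf ?_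
      rintro _ ⟨n, rfl, hn⟩
      have h0 : n ≠ 0 := by
        rintro rfl
        refine hL 0 (hn.mono ?_)
        rintro a ⟨b, hb⟩
        exact ⟨b, by rw [Fin.sum_univ_zero] at hb ⊢; exact hb⟩
      have h1 : n ≠ 1 := by
        rintro rfl
        exact hL 1 (hn.mono (right_sub_left hfd hsup hmono))
      have : 2 ≤ n := by omega
      exact_mod_cast this
  refine ⟨hl, hr, ?_⟩
  rw [hl, hr]
  exact ENat.top_ne_ofNat 2
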